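/- arXiv:2309.00243 — 5 statements merged into one kernel-verified Lean document; each statement's English description precedes it below -/
import Mathlib

section
/- Let k ≥ 1 be an integer and let c > 0, y ≥ 1, T ≥ 1 be real numbers. Then there is an absolute constant C₀ > 0 such that |(1/(2π)) ∫_{-T}^{T} y^{c+it} / ((c+it)(c+it+1)⋯(c+it+k)) dt − (1/k!)(1 − 1/y)^k| ≤ C₀ · 4^k · y^c / T^k. -/
open MeasureTheory Finset

/-- The counterclockwise integral of `f` over the boundary of `[a, b] × [-T, T]`. -/
noncomputable def rectBoundaryIntegral (f : ℂ → ℂ) (a b T : ℝ) : ℂ :=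
  (∫ x : ℝ in a..b, f (x + (-T : ℝ) * Complex.I)) - (∫ x : ℝ in a..b, f (x + T * Complex.I)) +
    Complex.I * (∫ t : ℝ in (-T)..T, f (b + t * Complex.I)) -
    Complex.I * (∫ t : ℝ in (-T)..T, f (a + t * Complex.I))

/-- The domain where the integrals in `rectBoundaryIntegral` are guaranteed to converge: `f` is
continuous along the four lines carrying the sides. -/
structure RectBoundaryContinuous (f : ℂ → ℂ) (a b T : ℝ) : Prop where
  bottom : Continuous fun x : ℝ ↦ f (x + (-T : ℝ) * Complex.I)
  top : Continuous fun x : ℝ ↦ f (x + T * Complex.I)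
  right : Continuous fun t : ℝ ↦ f (b + t * Complex.I)
  left : Continuous fun t : ℝ ↦ f (a + t * Complex.I)

lemma Continuous.rectBoundaryContinuous {f : ℂ → ℂ} (hf : Continuous f) (a b T : ℝ) :
    RectBoundaryContinuous f a b T := by
  constructor <;> fun_prop

lemma RectBoundaryContinuous.const_mul {f : ℂ → ℂ} {a b T : ℝ}
    (hf : RectBoundaryContinuous f a b T) (r : ℂ) :
    RectBoundaryContinuous (fun s ↦ r * f s) a b T :=
  ⟨hf.bottom.const_mul r, hf.top.const_mul r, hf.right.const_mul r, hf.left.const_mul r⟩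

lemma rectBoundaryIntegral_congr {f g : ℂ → ℂ} {a b T : ℝ} (hT : T ≠ 0)
    (h : ∀ s : ℂ, s.im ≠ 0 ∨ s.re = a ∨ s.re = b → f s = g s) :
    rectBoundaryIntegral f a b T = rectBoundaryIntegral g a b T := by
  unfold rectBoundaryIntegral
  have h1 (x : ℝ) : f (x + (-T : ℝ) * Complex.I) = g (x + (-T : ℝ) * Complex.I) :=
    h _ (Or.inl (by simpa))
  have h2 (x : ℝ) : f (x + T * Complex.I) = g (x + T * Complex.I) := h _ (Or.inl (by simpa))
  have h3 (t : ℝ) : f (b + t * Complex.I) = g (b + t * Complex.I) := h _ (by simp)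
  have h4 (t : ℝ) : f (a + t * Complex.I) = g (a + t * Complex.I) := h _ (by simp)
  simp only [h1, h2, h3, h4]

lemma rectBoundaryIntegral_const_mul (f : ℂ → ℂ) (a b T : ℝ) (r : ℂ) :
    rectBoundaryIntegral (fun s ↦ r * f s) a b T = r * rectBoundaryIntegral f a b T := by
  simp only [rectBoundaryIntegral, intervalIntegral.integral_const_mul]
  ring

lemma rectBoundaryIntegral_add {f g : ℂ → ℂ} {a b T : ℝ}
    (hf : RectBoundaryContinuous f a b T) (hg : RectBoundaryContinuous g a b T) :
    rectBoundaryIntegral (fun s ↦ f s + g s) a b T =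
      rectBoundaryIntegral f a b T + rectBoundaryIntegral g a b T := by
  simp only [rectBoundaryIntegral]
  rw [intervalIntegral.integral_add (hf.bottom.intervalIntegrable _ _)
      (hg.bottom.intervalIntegrable _ _),
    intervalIntegral.integral_add (hf.top.intervalIntegrable _ _) (hg.top.intervalIntegrable _ _),
    intervalIntegral.integral_add (hf.right.intervalIntegrable _ _)
      (hg.right.intervalIntegrable _ _),
    intervalIntegral.integral_add (hf.left.intervalIntegrable _ _)
      (hg.left.intervalIntegrable _ _)]
  ring

lemma rectBoundaryIntegral_finsetSum {ι : Type*} (S : Finset ι) {f : ι → ℂ → ℂ} {a b T : ℝ}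
    (hf : ∀ i ∈ S, RectBoundaryContinuous (f i) a b T) :
    rectBoundaryIntegral (fun s ↦ ∑ i ∈ S, f i s) a b T =
      ∑ i ∈ S, rectBoundaryIntegral (f i) a b T := by
  simp only [rectBoundaryIntegral]
  rw [intervalIntegral.integral_finsetSum fun i hi ↦ (hf i hi).bottom.intervalIntegrable _ _,
    intervalIntegral.integral_finsetSum fun i hi ↦ (hf i hi).top.intervalIntegrable _ _,
    intervalIntegral.integral_finsetSum fun i hi ↦ (hf i hi).right.intervalIntegrable _ _,
    intervalIntegral.integral_finsetSum fun i hi ↦ (hf i hi).left.intervalIntegrable _ _]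
  simp only [Finset.sum_add_distrib, Finset.sum_sub_distrib, Finset.mul_sum]

lemma rectBoundaryIntegral_eq_zero {f : ℂ → ℂ} (hf : Differentiable ℂ f) (a b T : ℝ) :
    rectBoundaryIntegral f a b T = 0 :=
  Complex.integral_boundary_rect_eq_zero_of_differentiableOn f ⟨a, -T⟩ ⟨b, T⟩
    hf.differentiableOn

lemma Complex.log_neg_of_im_pos {z : ℂ} (hz : 0 < z.im) :
    Complex.log (-z) = Complex.log z - Real.pi * Complex.I := by
  rw [Complex.log, Complex.log, Complex.arg_neg_eq_arg_sub_pi_of_im_pos hz, norm_neg]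
  push_cast
  ring

lemma Complex.log_neg_of_im_neg {z : ℂ} (hz : z.im < 0) :
    Complex.log (-z) = Complex.log z + Real.pi * Complex.I := by
  rw [Complex.log, Complex.log, Complex.arg_neg_eq_arg_add_pi_of_im_neg hz, norm_neg]
  push_cast
  ring

lemma rectBoundaryContinuous_inv_sub {a b T p : ℝ} (ha : a ≠ p) (hb : b ≠ p) (hT : T ≠ 0) :
    RectBoundaryContinuous (fun s ↦ (s - p)⁻¹) a b T := by
  constructor <;> refine Continuous.inv₀ (by fun_prop) fun x h ↦ ?_
  · simpa [hT] using congrArg Complex.im h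
  · simpa [hT] using congrArg Complex.im h
  · exact hb (by simpa [sub_eq_zero] using congrArg Complex.re h)
  · exact ha (by simpa [sub_eq_zero] using congrArg Complex.re h)

lemma integral_inv_horizontal {a b T : ℝ} (p : ℝ) (hT : T ≠ 0) :
    ∫ x : ℝ in a..b, ((x : ℂ) + T * Complex.I - p)⁻¹ =
      Complex.log (b + T * Complex.I - p) - Complex.log (a + T * Complex.I - p) := by
  have hne (x : ℝ) : (x : ℂ) + T * Complex.I - p ≠ 0 := fun h ↦ by
    simpa [hT] using congrArg Complex.im h
  refine intervalIntegral.integral_eq_sub_of_hasDerivAt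
    (f := fun x : ℝ ↦ Complex.log (x + T * Complex.I - p)) (fun x _ ↦ ?_) ?_
  · have h := ((Complex.ofRealCLM.hasDerivAt (x := x)).add_const (T * Complex.I)).sub_const (p : ℂ)
    simpa using h.clog_real (Or.inr (by simpa))
  · exact (Continuous.inv₀ (by fun_prop) hne).intervalIntegrable _ _

lemma rectBoundaryIntegral_inv_sub {a b T p : ℝ} (ha : a < p) (hb : p < b) (hT : 0 < T) :
    rectBoundaryIntegral (fun s ↦ (s - p)⁻¹) a b T = 2 * Real.pi * Complex.I := by
  have hC := rectBoundaryContinuous_inv_sub ha.ne hb.ne' hT.ne'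
  have hderiv (t : ℝ) : HasDerivAt (fun t : ℝ ↦ (t : ℂ) * Complex.I) Complex.I t := by
    simpa using (Complex.ofRealCLM.hasDerivAt (x := t)).mul_const Complex.I
  have hright : Complex.I * ∫ t : ℝ in (-T)..T, ((b : ℂ) + t * Complex.I - p)⁻¹ =
      Complex.log (b + T * Complex.I - p) - Complex.log (b + (-T : ℝ) * Complex.I - p) := by
    rw [← intervalIntegral.integral_const_mul]
    refine intervalIntegral.integral_eq_sub_of_hasDerivAt
      (f := fun t : ℝ ↦ Complex.log (b + t * Complex.I - p)) (fun t _ ↦ ?_) ?_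
    · have h := ((hderiv t).const_add (b : ℂ)).sub_const (p : ℂ)
      simpa [div_eq_mul_inv] using h.clog_real (Or.inl (by simpa))
    · exact (hC.right.const_mul _).intervalIntegrable _ _
  have hleft : Complex.I * ∫ t : ℝ in (-T)..T, ((a : ℂ) + t * Complex.I - p)⁻¹ =
      Complex.log (-(a + T * Complex.I - p)) - Complex.log (-(a + (-T : ℝ) * Complex.I - p)) := by
    rw [← intervalIntegral.integral_const_mul]
    refine intervalIntegral.integral_eq_sub_of_hasDerivAt
      (f := fun t : ℝ ↦ Complex.log (-(a + t * Complex.I - p))) (fun t _ ↦ ?_) ?_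
    · have h := (((hderiv t).const_add (a : ℂ)).sub_const (p : ℂ)).fun_neg
      have h' := h.clog_real (Or.inl (by simpa))
      rwa [neg_div_neg_eq, div_eq_mul_inv] at h'
    · exact (hC.left.const_mul _).intervalIntegrable _ _
  rw [rectBoundaryIntegral, integral_inv_horizontal p (neg_ne_zero.2 hT.ne'),
    integral_inv_horizontal p hT.ne', hright, hleft, Complex.log_neg_of_im_pos (by simpa),
    Complex.log_neg_of_im_neg (by simpa)]
  ring

/-- **Cauchy's integral formula** for a rectangle and a real point. -/
lemma rectBoundaryIntegral_mul_inv_sub {f : ℂ → ℂ} (hf : Differentiable ℂ f) {a b T p : ℝ}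
    (ha : a < p) (hb : p < b) (hT : 0 < T) :
    rectBoundaryIntegral (fun s ↦ f s * (s - p)⁻¹) a b T = 2 * Real.pi * Complex.I * f p := by
  have hd : Differentiable ℂ (dslope f (p : ℂ)) := by
    rw [← differentiableOn_univ, Complex.differentiableOn_dslope Filter.univ_mem]
    exact hf.differentiableOn
  rw [rectBoundaryIntegral_congr (g := fun s ↦ dslope f p s + f p * (s - p)⁻¹) hT.ne',
    rectBoundaryIntegral_add (hd.continuous.rectBoundaryContinuous ..)
      ((rectBoundaryContinuous_inv_sub ha.ne hb.ne' hT.ne').const_mul _),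
    rectBoundaryIntegral_eq_zero hd, rectBoundaryIntegral_const_mul,
    rectBoundaryIntegral_inv_sub ha hb hT]
  · ring
  · intro s hs
    have hne : s ≠ p := by
      rintro rfl
      rcases hs with h | h | h
      · simp at h
      · exact ha.ne' (by simpa using h)
      · exact hb.ne (by simpa using h)
    rw [dslope_of_ne _ hne, slope_def_field]
    ring

/-- Partial fraction decomposition of `k! / (s (s + 1) ⋯ (s + k))`. -/
lemma factorial_div_prod_add_natCast {K : Type*} [Field K] [CharZero K] (k : ℕ) (s : K)
    (hs : ∀ j ∈ range (k + 1), s + j ≠ 0) :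
    (k.factorial : K) / ∏ j ∈ range (k + 1), (s + j) =
      ∑ j ∈ range (k + 1), (-1) ^ j * (k.choose j : K) * (s + j)⁻¹ := by
  induction k generalizing s with
  | zero => simp
  | succ k ih =>
    have hs1 : ∀ j ∈ range (k + 1), s + 1 + j ≠ 0 := fun j hj ↦ by
      have := hs (j + 1) (by simp at hj ⊢; omega)
      push_cast at this
      rwa [add_assoc, add_comm 1]
    have hpascal : ∑ j ∈ range (k + 1 + 1), (-1) ^ j * ((k + 1).choose j : K) * (s + j)⁻¹ =
        ∑ j ∈ range (k + 1), (-1) ^ j * (k.choose j : K) * (s + j)⁻¹ -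
          ∑ j ∈ range (k + 1), (-1) ^ j * (k.choose j : K) * (s + 1 + j)⁻¹ := by
      have h := sum_range_succ (fun j ↦ (-1) ^ j * (k.choose j : K) * (s + j)⁻¹) (k + 1)
      rw [Nat.choose_succ_self] at h
      rw [show ∑ j ∈ range (k + 1), (-1) ^ j * (k.choose j : K) * (s + j)⁻¹ =
        ∑ j ∈ range (k + 1 + 1), (-1) ^ j * (k.choose j : K) * (s + j)⁻¹ by simp [h],
        sum_range_succ' _ (k + 1), sum_range_succ' _ (k + 1), add_sub_right_comm,
        ← sum_sub_distrib]
      congr 1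
      · refine sum_congr rfl fun j _ ↦ ?_
        rw [Nat.choose_succ_succ]
        push_cast
        rw [show s + 1 + (j : K) = s + (j + 1) by ring]
        ring
      · simp
    rw [hpascal, ← ih s fun j hj ↦ hs j (by simp at hj ⊢; omega), ← ih (s + 1) hs1]
    have hP : ∏ j ∈ range (k + 1 + 1), (s + j) = s * ∏ j ∈ range (k + 1), (s + 1 + j) := by
      rw [prod_range_succ', mul_comm]
      push_cast
      simp only [add_zero, add_assoc, add_comm (1 : K)]
    have hQ : ∏ j ∈ range (k + 1 + 1), (s + j) =
        (∏ j ∈ range (k + 1), (s + j)) * (s + (k + 1 : ℕ)) := prod_range_succ _ _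
    have h0 := prod_ne_zero_iff.2 hs
    have h1 := left_ne_zero_of_mul (hQ ▸ h0)
    have h2 := prod_ne_zero_iff.2 hs1
    have h3 := left_ne_zero_of_mul (hP ▸ h0)
    rw [div_sub_div _ _ h1 h2, div_eq_div_iff h0 (mul_ne_zero h1 h2), Nat.factorial_succ]
    have hPQ := hP.symm.trans hQ
    push_cast at hPQ ⊢
    rw [hP]
    linear_combination (-(k.factorial : K)) * (∏ j ∈ range (k + 1), (s + 1 + j)) * hPQ

lemma rectBoundaryIntegral_cpow_div_prod (k : ℕ) {a b y T : ℝ} (ha : a < -k) (hb : 0 < b)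
    (hy : 0 < y) (hT : 0 < T) :
    rectBoundaryIntegral (fun s ↦ (y : ℂ) ^ s / ∏ j ∈ range (k + 1), (s + j)) a b T =
      2 * Real.pi * Complex.I * ((1 / (k.factorial : ℝ) * (1 - 1 / y) ^ k : ℝ) : ℂ) := by
  have hy0 : (y : ℂ) ≠ 0 := by exact_mod_cast hy.ne'
  have hf : Differentiable ℂ fun s : ℂ ↦ (y : ℂ) ^ s := fun s ↦
    differentiableAt_id.const_cpow (Or.inl hy0)
  have haj {j : ℕ} (hj : j ∈ range (k + 1)) : a < (-j : ℝ) := by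
    have : (j : ℝ) ≤ k := by exact_mod_cast Nat.lt_succ_iff.1 (mem_range.1 hj)
    linarith
  have hbj (j : ℕ) : (-j : ℝ) < b := by
    have : (0 : ℝ) ≤ j := j.cast_nonneg
    linarith
  have hk : (k.factorial : ℂ) ≠ 0 := by exact_mod_cast k.factorial_ne_zero
  rw [rectBoundaryIntegral_congr (g := fun s ↦ ∑ j ∈ range (k + 1),
      ((k.factorial : ℂ)⁻¹ * ((-1) ^ j * (k.choose j : ℂ))) *
        ((y : ℂ) ^ s * (s - (-j : ℝ))⁻¹)) hT.ne',
    rectBoundaryIntegral_finsetSum]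
  · rw [sum_congr rfl fun j hj ↦ (rectBoundaryIntegral_const_mul _ a b T _).trans
      (congrArg _ (rectBoundaryIntegral_mul_inv_sub hf (haj hj) (hbj j) hT))]
    have hbinom : (1 - 1 / (y : ℂ)) ^ k =
        ∑ j ∈ range (k + 1), (-1) ^ j * (k.choose j : ℂ) * (y : ℂ) ^ ((-j : ℝ) : ℂ) := by
      rw [sub_eq_neg_add, add_pow]
      refine sum_congr rfl fun j _ ↦ ?_
      push_cast
      rw [Complex.cpow_neg, Complex.cpow_natCast, neg_pow, one_div, inv_pow]
      ring
    push_cast at hbinom ⊢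
    rw [hbinom, mul_sum, mul_sum]
    refine sum_congr rfl fun j _ ↦ ?_
    rw [one_div]
    ring
  · intro j hj
    refine RectBoundaryContinuous.const_mul ?_ _
    have h1 := hf.continuous.rectBoundaryContinuous a b T
    have h2 := rectBoundaryContinuous_inv_sub (haj hj).ne (hbj j).ne' hT.ne'
    exact ⟨h1.bottom.mul h2.bottom, h1.top.mul h2.top, h1.right.mul h2.right,
      h1.left.mul h2.left⟩
  · intro s hs
    have hne : ∀ j ∈ range (k + 1), s + j ≠ 0 := by
      intro j hj h
      obtain rfl : s = ((-j : ℝ) : ℂ) := by push_cast; exact eq_neg_of_add_eq_zero_left h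
      rcases hs with h | h | h
      · exact h (Complex.ofReal_im _)
      · exact (haj hj).ne' ((Complex.ofReal_re _).symm.trans h)
      · exact (hbj j).ne ((Complex.ofReal_re _).symm.trans h)
    have h := factorial_div_prod_add_natCast k s hne
    rw [← inv_mul_cancel_left₀ hk ((y : ℂ) ^ s / _), mul_div_left_comm, h, mul_sum, mul_sum]
    refine sum_congr rfl fun j _ ↦ ?_
    push_cast
    rw [sub_neg_eq_add]
    ring

/-- Bounding `1 / |s (s + 1)|` by the mean of `1 / |s|²` and `1 / |s + 1|²` makes the horizontal
integral converge without any decay of `y ^ s`. -/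
lemma norm_cpow_div_prod_le (k : ℕ) (hk : 1 ≤ k) {y T x b : ℝ} (hy : 1 ≤ y) (hT : T ≠ 0)
    (hx : x ≤ b) :
    ‖(y : ℂ) ^ ((x : ℂ) + T * Complex.I) /
        ∏ j ∈ range (k + 1), ((x : ℂ) + T * Complex.I + j)‖ ≤
      y ^ b / |T| ^ (k - 1) * ((1 / 2) * ((T ^ 2 + x ^ 2)⁻¹ + (T ^ 2 + (x + 1) ^ 2)⁻¹)) := by
  obtain ⟨m, rfl⟩ := Nat.exists_eq_add_of_le' hk
  have hT' : 0 < |T| := abs_pos.2 hT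
  have hT2 : 0 < T ^ 2 := by positivity
  have hnum : ‖(y : ℂ) ^ ((x : ℂ) + T * Complex.I)‖ ≤ y ^ b := by
    rw [Complex.norm_cpow_eq_rpow_re_of_pos (by linarith)]
    simpa using Real.rpow_le_rpow_of_exponent_le hy hx
  have hnorm (j : ℕ) : ‖(x : ℂ) + T * Complex.I + j‖ ^ 2 = T ^ 2 + (x + j) ^ 2 := by
    rw [← Complex.normSq_eq_norm_sq, Complex.normSq_apply]
    simp
    ring
  have hprod : |T| ^ m ≤ ∏ j ∈ range m, ‖(x : ℂ) + T * Complex.I + (j + 1 + 1 : ℕ)‖ := by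
    rw [← card_range m, ← prod_const, card_range]
    refine prod_le_prod (fun _ _ ↦ hT'.le) fun j _ ↦ ?_
    simpa using Complex.abs_im_le_norm ((x : ℂ) + T * Complex.I + (j + 1 + 1 : ℕ))
  have h0 := hnorm 0
  have h1 := hnorm 1
  rw [norm_div, norm_prod, prod_range_succ', prod_range_succ']
  set A := ‖(x : ℂ) + T * Complex.I + (0 : ℕ)‖
  set B := ‖(x : ℂ) + T * Complex.I + (0 + 1 : ℕ)‖
  have hA : 0 < A := by
    refine lt_of_le_of_ne (norm_nonneg _) fun h ↦ ?_
    rw [← h] at h0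
    nlinarith [sq_nonneg (x + (0 : ℕ))]
  have hB : 0 < B := by
    refine lt_of_le_of_ne (norm_nonneg _) fun h ↦ ?_
    have h1' : B ^ 2 = T ^ 2 + (x + (1 : ℕ)) ^ 2 := h1
    rw [← h] at h1'
    nlinarith [sq_nonneg (x + (1 : ℕ))]
  have hAB : (B * A)⁻¹ ≤ (1 / 2) * ((T ^ 2 + x ^ 2)⁻¹ + (T ^ 2 + (x + 1) ^ 2)⁻¹) := by
    have e0 : T ^ 2 + x ^ 2 = A ^ 2 := by simpa using h0.symm
    have e1 : T ^ 2 + (x + 1) ^ 2 = B ^ 2 := by simpa using h1.symm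
    rw [e0, e1, mul_inv, ← inv_pow, ← inv_pow]
    nlinarith [sq_nonneg (A⁻¹ - B⁻¹)]
  rw [mul_assoc, ← div_div, div_eq_mul_inv _ (B * A), Nat.add_sub_cancel]
  gcongr

lemma integral_inv_sq_add_sq_le {T : ℝ} (hT : 0 < T) (a b : ℝ) :
    ∫ x in a..b, (T ^ 2 + x ^ 2)⁻¹ ≤ Real.pi / T := by
  have h : ∫ x in a..b, (T ^ 2 + x ^ 2)⁻¹ =
      T⁻¹ * Real.arctan (b / T) - T⁻¹ * Real.arctan (a / T) := by
    refine intervalIntegral.integral_eq_sub_of_hasDerivAt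
      (f := fun x ↦ T⁻¹ * Real.arctan (x / T)) (fun x _ ↦ ?_) ?_
    · refine (((hasDerivAt_id' x).div_const T).arctan.const_mul T⁻¹).congr_deriv ?_
      field_simp
    · exact (Continuous.inv₀ (by fun_prop) fun x ↦ by positivity).intervalIntegrable _ _
  rw [h, ← mul_sub, div_eq_inv_mul Real.pi]
  refine mul_le_mul_of_nonneg_left ?_ (inv_nonneg.2 hT.le)
  linarith [Real.arctan_lt_pi_div_two (b / T), Real.neg_pi_div_two_lt_arctan (a / T)]

lemma norm_integral_horizontal_le (k : ℕ) (hk : 1 ≤ k) {a b y T : ℝ} (hy : 1 ≤ y) (hT : T ≠ 0)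
    (hab : a ≤ b) :
    ‖∫ x : ℝ in a..b, (y : ℂ) ^ ((x : ℂ) + T * Complex.I) /
        ∏ j ∈ range (k + 1), ((x : ℂ) + T * Complex.I + j)‖ ≤ Real.pi * y ^ b / |T| ^ k := by
  have hT' : 0 < |T| := abs_pos.2 hT
  have hc1 : Continuous fun x : ℝ ↦ (T ^ 2 + x ^ 2)⁻¹ :=
    Continuous.inv₀ (by fun_prop) fun x ↦ by positivity
  have hc2 : Continuous fun x : ℝ ↦ (T ^ 2 + (x + 1) ^ 2)⁻¹ :=
    hc1.comp (continuous_add_const 1)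
  have hy' : 0 ≤ y ^ b := Real.rpow_nonneg (by linarith) _
  have h1 := integral_inv_sq_add_sq_le hT' a b
  have h2 := integral_inv_sq_add_sq_le hT' (a + 1) (b + 1)
  rw [sq_abs] at h1 h2
  calc _ ≤ ∫ x : ℝ in a..b, y ^ b / |T| ^ (k - 1) *
        ((1 / 2) * ((T ^ 2 + x ^ 2)⁻¹ + (T ^ 2 + (x + 1) ^ 2)⁻¹)) :=
        intervalIntegral.norm_integral_le_of_norm_le hab
          (.of_forall fun x hx ↦ norm_cpow_div_prod_le k hk hy hT hx.2)
          (Continuous.intervalIntegrable (by fun_prop) _ _)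
    _ = y ^ b / |T| ^ (k - 1) * ((1 / 2) * ((∫ x in a..b, (T ^ 2 + x ^ 2)⁻¹) +
        ∫ x in (a + 1)..(b + 1), (T ^ 2 + x ^ 2)⁻¹)) := by
        rw [intervalIntegral.integral_const_mul, intervalIntegral.integral_const_mul,
          intervalIntegral.integral_add (hc1.intervalIntegrable _ _) (hc2.intervalIntegrable _ _),
          intervalIntegral.integral_comp_add_right (fun x ↦ (T ^ 2 + x ^ 2)⁻¹)]
    _ ≤ y ^ b / |T| ^ (k - 1) * (Real.pi / |T|) := by
        gcongr
        linarith
    _ = Real.pi * y ^ b / |T| ^ k := by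
        rw [← Nat.sub_add_cancel hk, pow_succ, Nat.add_sub_cancel]
        field_simp

lemma norm_integral_left_le (k : ℕ) {y T N : ℝ} (hy : 1 ≤ y) (hT : 0 ≤ T) (hN : 1 ≤ N) :
    ‖∫ t : ℝ in (-T)..T, (y : ℂ) ^ (((-k - N : ℝ) : ℂ) + t * Complex.I) /
        ∏ j ∈ range (k + 1), (((-k - N : ℝ) : ℂ) + t * Complex.I + j)‖ ≤ 2 * T * N⁻¹ := by
  have h : ∀ t ∈ Set.uIoc (-T) T, ‖(y : ℂ) ^ (((-k - N : ℝ) : ℂ) + t * Complex.I) /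
        ∏ j ∈ range (k + 1), (((-k - N : ℝ) : ℂ) + t * Complex.I + j)‖ ≤ N⁻¹ := by
    intro t _
    rw [norm_div, norm_prod, inv_eq_one_div]
    refine div_le_div₀ zero_le_one ?_ (by linarith) ?_
    · rw [Complex.norm_cpow_eq_rpow_re_of_pos (by linarith)]
      refine Real.rpow_le_one_of_one_le_of_nonpos hy ?_
      have : (0 : ℝ) ≤ k := k.cast_nonneg
      simp
      linarith
    · calc N ≤ N ^ (k + 1) := le_self_pow₀ hN k.succ_ne_zero
        _ = ∏ j ∈ range (k + 1), N := by simp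
        _ ≤ _ := prod_le_prod (fun _ _ ↦ by linarith) fun j hj ↦ ?_
      refine le_trans ?_ (Complex.abs_re_le_norm _)
      have : (j : ℝ) ≤ k := by exact_mod_cast Nat.lt_succ_iff.1 (mem_range.1 hj)
      refine le_trans ?_ (neg_le_abs _)
      simp
      linarith
  refine (intervalIntegral.norm_integral_le_of_norm_le_const h).trans_eq ?_
  rw [sub_neg_eq_add, abs_of_nonneg (by linarith)]
  ring

/-- Truncated Perron-type formula, case `y ≥ 1` (Lemma 3.4 of the paper):
there is an absolute constant `C₀ > 0` such that for every integer `k ≥ 1`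
and reals `c > 0`, `y ≥ 1`, `T ≥ 1`,
`|(1/(2π)) ∫_{-T}^{T} y^{c+it}/((c+it)(c+it+1)⋯(c+it+k)) dt − (1/k!)(1−1/y)^k|
  ≤ C₀ · 4^k · y^c / T^k`. -/
theorem perron_truncated_y_ge_one :
    ∃ C₀ : ℝ, 0 < C₀ ∧
      ∀ (k : ℕ), 1 ≤ k → ∀ (c y T : ℝ), 0 < c → 1 ≤ y → 1 ≤ T →
        ‖(1 / (2 * Real.pi) : ℂ) *
              (∫ t in (-T)..T,
                (y : ℂ) ^ ((c : ℂ) + (t : ℂ) * Complex.I) /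
                  ∏ j ∈ Finset.range (k + 1), ((c : ℂ) + (t : ℂ) * Complex.I + (j : ℂ))) -
            ((1 / (Nat.factorial k : ℝ) * (1 - 1 / y) ^ k : ℝ) : ℂ)‖ ≤
          C₀ * 4 ^ k * y ^ c / T ^ k := by
  refine ⟨1, one_pos, fun k hk c y T hc hy hT ↦ ?_⟩
  have hT0 : 0 < T := by linarith
  have hyc : 0 ≤ y ^ c := Real.rpow_nonneg (by linarith) _
  have hπ := Real.pi_pos
  have key : ∀ᶠ N : ℝ in Filter.atTop,
      ‖(1 / (2 * Real.pi) : ℂ) *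
            (∫ t in (-T)..T, (y : ℂ) ^ ((c : ℂ) + (t : ℂ) * Complex.I) /
                ∏ j ∈ Finset.range (k + 1), ((c : ℂ) + (t : ℂ) * Complex.I + (j : ℂ))) -
          ((1 / (Nat.factorial k : ℝ) * (1 - 1 / y) ^ k : ℝ) : ℂ)‖ ≤
        y ^ c / T ^ k + T / Real.pi * N⁻¹ := by
    filter_upwards [Filter.eventually_ge_atTop 1] with N hN
    have hk0 : (0 : ℝ) ≤ k := k.cast_nonneg
    have hR := rectBoundaryIntegral_cpow_div_prod k (a := -k - N) (by linarith) hc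
      (by linarith : 0 < y) hT0
    have hbot := norm_integral_horizontal_le k hk (a := -k - N) (b := c) hy
      (neg_ne_zero.2 hT0.ne') (by linarith)
    have htop := norm_integral_horizontal_le k hk (a := -k - N) (b := c) hy hT0.ne' (by linarith)
    have hleft := norm_integral_left_le k hy hT0.le hN
    rw [abs_neg, abs_of_pos hT0] at hbot
    rw [abs_of_pos hT0] at htop
    rw [rectBoundaryIntegral] at hR
    set Jb := ∫ x : ℝ in (-k - N)..c, (y : ℂ) ^ ((x : ℂ) + (-T : ℝ) * Complex.I) /
        ∏ j ∈ range (k + 1), ((x : ℂ) + (-T : ℝ) * Complex.I + j)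
    set Jt := ∫ x : ℝ in (-k - N)..c, (y : ℂ) ^ ((x : ℂ) + T * Complex.I) /
        ∏ j ∈ range (k + 1), ((x : ℂ) + T * Complex.I + j)
    set Jl := ∫ t : ℝ in (-T)..T, (y : ℂ) ^ (((-k - N : ℝ) : ℂ) + t * Complex.I) /
        ∏ j ∈ range (k + 1), (((-k - N : ℝ) : ℂ) + t * Complex.I + j)
    set J := ∫ t : ℝ in (-T)..T, (y : ℂ) ^ ((c : ℂ) + t * Complex.I) /
        ∏ j ∈ range (k + 1), ((c : ℂ) + t * Complex.I + j)
    set M : ℂ := ((1 / (Nat.factorial k : ℝ) * (1 - 1 / y) ^ k : ℝ) : ℂ)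
    have hπ' : (Real.pi : ℂ) ≠ 0 := by exact_mod_cast hπ.ne'
    have hdiff : (1 / (2 * Real.pi) : ℂ) * J - M =
        ((1 / (2 * Real.pi) : ℝ) : ℂ) * (Complex.I * (Jb - Jt) + Jl) := by
      push_cast
      field_simp
      linear_combination (-Complex.I) * hR + (J - Jl - 2 * Real.pi * M) * Complex.I_sq
    have hpos : (0 : ℝ) ≤ 1 / (2 * Real.pi) := by positivity
    rw [hdiff, norm_mul, Complex.norm_real, Real.norm_of_nonneg hpos]
    calc _ ≤ 1 / (2 * Real.pi) *
          ((Real.pi * y ^ c / T ^ k + Real.pi * y ^ c / T ^ k) + 2 * T * N⁻¹) := by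
          gcongr
          refine (norm_add_le _ _).trans (add_le_add ?_ hleft)
          rw [norm_mul, Complex.norm_I, one_mul]
          exact (norm_sub_le _ _).trans (add_le_add hbot htop)
      _ = _ := by
          field_simp
          ring
  have hlim : Filter.Tendsto (fun N : ℝ ↦ y ^ c / T ^ k + T / Real.pi * N⁻¹) Filter.atTop
      (nhds (y ^ c / T ^ k)) := by
    simpa using (tendsto_inv_atTop_zero.const_mul (T / Real.pi)).const_add (y ^ c / T ^ k)
  refine (ge_of_tendsto hlim key).trans ?_
  gcongr
  rw [one_mul]
  exact le_mul_of_one_le_left hyc (one_le_pow₀ (by norm_num))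
end

section
/- Let k ≥ 1 be an integer and let c > 0, 0 < y ≤ 1, T ≥ 1 be real numbers. Then there is an absolute constant C₀ > 0 such that |(1/(2π)) ∫_{-T}^{T} y^{c+it} / ((c+it)(c+it+1)⋯(c+it+k)) dt| ≤ C₀ / T^k. -/
/-- The integrand `y ^ s / (s (s + 1) ⋯ (s + k))` is at most `1 / T ^ (k + 1)` in norm at a point
`s` of positive real part, provided that `0 < y ≤ 1` and that `T` is at most `|re s|` or `|im s|`. -/
lemma norm_cpow_div_prod_le_s1 {k : ℕ} {y T : ℝ} (hy : 0 < y) (hy1 : y ≤ 1) (hT : 0 < T) {s : ℂ}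
    (hs : 0 < s.re) (h : T ≤ s.re ∨ T ≤ |s.im|) :
    ‖(y : ℂ) ^ s / ∏ j ∈ Finset.range (k + 1), (s + (j : ℂ))‖ ≤ 1 / T ^ (k + 1) := by
  have hfactor (j : ℕ) : T ≤ ‖s + (j : ℂ)‖ := by
    rcases h with h | h
    · have := Complex.re_le_norm (s + (j : ℂ))
      simp only [Complex.add_re, Complex.natCast_re] at this
      linarith [Nat.cast_nonneg (α := ℝ) j]
    · have := Complex.abs_im_le_norm (s + (j : ℂ))
      simp only [Complex.add_im, Complex.natCast_im, add_zero] at this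
      linarith
  rw [norm_div, norm_prod, Complex.norm_cpow_eq_rpow_re_of_pos hy]
  have hprod : T ^ (k + 1) ≤ ∏ j ∈ Finset.range (k + 1), ‖s + (j : ℂ)‖ := by
    simpa using Finset.prod_le_prod (s := Finset.range (k + 1)) (f := fun _ => T)
      (fun _ _ => hT.le) (fun j _ => hfactor j)
  exact div_le_div₀ zero_le_one (Real.rpow_le_one hy.le hy1 hs.le) (by positivity) hprod

/-- The integrand `y ^ s / (s (s + 1) ⋯ (s + k))` is holomorphic on the right half-plane. -/
lemma differentiableAt_cpow_div_prod (k : ℕ) {y : ℝ} (hy : 0 < y) {s : ℂ} (hs : 0 < s.re) :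
    DifferentiableAt ℂ
      (fun s : ℂ => (y : ℂ) ^ s / ∏ j ∈ Finset.range (k + 1), (s + (j : ℂ))) s := by
  have hy0 : (y : ℂ) ≠ 0 := by exact_mod_cast hy.ne'
  refine (differentiableAt_id.const_cpow (Or.inl hy0)).div (by fun_prop) ?_
  refine Finset.prod_ne_zero_iff.mpr fun j _ h0 => ?_
  have := congrArg Complex.re h0
  simp only [Complex.add_re, Complex.natCast_re, Complex.zero_re] at this
  linarith [Nat.cast_nonneg (α := ℝ) j]

/-- Truncated Perron-type formula, case `0 < y ≤ 1` (Lemma 3.4 of the paper):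
there is an absolute constant `C₀ > 0` such that for every integer `k ≥ 1`
and reals `c > 0`, `0 < y ≤ 1`, `T ≥ 1`,
`|(1/(2π)) ∫_{-T}^{T} y^{c+it}/((c+it)(c+it+1)⋯(c+it+k)) dt| ≤ C₀ / T^k`. -/
theorem perron_truncated_y_le_one :
    ∃ C₀ : ℝ, 0 < C₀ ∧
      ∀ (k : ℕ), 1 ≤ k → ∀ (c y T : ℝ), 0 < c → 0 < y → y ≤ 1 → 1 ≤ T →
        ‖(1 / (2 * Real.pi) : ℂ) *
            ∫ t in (-T)..T,
              (y : ℂ) ^ ((c : ℂ) + (t : ℂ) * Complex.I) /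
                ∏ j ∈ Finset.range (k + 1), ((c : ℂ) + (t : ℂ) * Complex.I + (j : ℂ))‖ ≤
          C₀ / T ^ k := by
  refine ⟨1, one_pos, fun k _ c y T hc hy hy1 hT1 => ?_⟩
  have hT : 0 < T := by linarith
  set f : ℂ → ℂ := fun s => (y : ℂ) ^ s / ∏ j ∈ Finset.range (k + 1), (s + (j : ℂ))
  change ‖(1 / (2 * Real.pi) : ℂ) * ∫ t in (-T)..T, f ((c : ℂ) + (t : ℂ) * Complex.I)‖ ≤ _
  -- Shift the segment to the right by `T` with Cauchy's theorem on a rectangle.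
  have hrect := Complex.integral_boundary_rect_eq_zero_of_differentiableOn f
    ⟨c, -T⟩ ⟨c + T, T⟩ (fun s hs => by
      have hre : s.re ∈ Set.uIcc c (c + T) := hs.1
      rw [Set.uIcc_of_le (by linarith)] at hre
      exact (differentiableAt_cpow_div_prod k hy (hc.trans_le hre.1)).differentiableWithinAt)
  simp only at hrect
  have hhor (u : ℝ) (hu : |u| = T) :
      ‖∫ x in c..(c + T), f ((x : ℂ) + (u : ℂ) * Complex.I)‖ ≤ 1 / T ^ k := by
    refine (intervalIntegral.norm_integral_le_of_norm_le_const
      (C := 1 / T ^ (k + 1)) fun x hx => ?_).trans_eq ?_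
    · rw [Set.uIoc_of_le (by linarith)] at hx
      exact norm_cpow_div_prod_le_s1 hy hy1 hT (by simpa using hc.trans hx.1)
        (Or.inr (by simp [hu]))
    · rw [add_sub_cancel_left, abs_of_pos hT]
      field_simp
      ring
  have hvert : ‖∫ t in (-T)..T, f (((c + T : ℝ) : ℂ) + (t : ℂ) * Complex.I)‖ ≤ 2 / T ^ k := by
    refine (intervalIntegral.norm_integral_le_of_norm_le_const
      (C := 1 / T ^ (k + 1)) fun t _ => ?_).trans_eq ?_
    · exact norm_cpow_div_prod_le_s1 hy hy1 hT (by simpa using add_pos hc hT)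
        (Or.inl (by simpa using hc.le))
    · rw [sub_neg_eq_add, abs_of_pos (by linarith)]
      field_simp
      ring
  have hbot := hhor (-T) (by rw [abs_neg, abs_of_pos hT])
  have htop := hhor T (abs_of_pos hT)
  have hnorm : ‖∫ t in (-T)..T, f ((c : ℂ) + (t : ℂ) * Complex.I)‖ ≤ 4 / T ^ k := by
    rw [sub_eq_zero] at hrect
    have h := congrArg norm hrect
    rw [norm_smul, Complex.norm_I, one_mul] at h
    rw [← h]
    refine (norm_add_le _ _).trans ?_
    rw [norm_smul, Complex.norm_I, one_mul]
    refine (add_le_add ((norm_sub_le _ _).trans (add_le_add hbot htop)) hvert).trans_eq ?_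
    ring
  have hpi : ‖(1 / (2 * Real.pi) : ℂ)‖ = 1 / (2 * Real.pi) := by
    simp [abs_of_pos Real.pi_pos]
  rw [norm_mul, hpi]
  calc 1 / (2 * Real.pi) * _ ≤ 1 / 4 * (4 / T ^ k) := by
        gcongr
        linarith [Real.pi_gt_three]
    _ = 1 / T ^ k := by ring
end

section
/- Let A : [1,∞) → ℝ be nondecreasing and let B(x) = (1/x) ∫_1^x A(t) dt for x ≥ 1. Let c > 0 be a real constant, and let E : [1,∞) → ℝ be nondecreasing with E(x) ≥ 1 for all x ≥ 1, E(x) → ∞ as x → ∞, and E(2x) ≤ D·E(x) for some constant D ≥ 1 and all x ≥ 1. Suppose there is a constant K such that |B(x) − cx| ≤ K·x/E(x) for all x ≥ 1. Then there exist a constant K' and x₀ ≥ 1 such that |A(x) − 2cx| ≤ K'·x/√(E(x)) for all x ≥ x₀. -/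
open MeasureTheory

/-- The integral of a monotone function over `[a, b]` is at least the length of the interval times
the value at the left endpoint, and at most the length times the value at the right endpoint. -/
theorem MonotoneOn.sub_mul_le_intervalIntegral_and_le {f : ℝ → ℝ} {a b : ℝ} (hab : a ≤ b)
    (hf : MonotoneOn f (Set.Icc a b)) :
    (b - a) * f a ≤ ∫ t in a..b, f t ∧ ∫ t in a..b, f t ≤ (b - a) * f b := by
  have hint : IntervalIntegrable f volume a b := by
    apply MonotoneOn.intervalIntegrable
    rwa [Set.uIcc_of_le hab]
  constructor
  · have h := intervalIntegral.integral_mono_on hab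
      (intervalIntegrable_const (c := f a)) hint
      (fun t ht => hf (Set.left_mem_Icc.2 hab) ht ht.1)
    simpa using h
  · have h := intervalIntegral.integral_mono_on hab hint
      (intervalIntegrable_const (c := f b))
      (fun t ht => hf ht (Set.right_mem_Icc.2 hab) ht.2)
    simpa using h

/-- Tauberian reduction lemma (Lemma 3.5 of the paper, after Ingham):
if `A` is nondecreasing on `[1,∞)`, `B(x) = (1/x) ∫_1^x A(t) dt`, `c > 0`,
`E` is nondecreasing on `[1,∞)` with `E(x) ≥ 1`, `E(x) → ∞`, `E(2x) ≤ D·E(x)`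
for a constant `D ≥ 1`, and `|B(x) − cx| ≤ K·x/E(x)` for all `x ≥ 1`, then
`|A(x) − 2cx| ≤ K'·x/√(E(x))` for some constant `K'` and all sufficiently large `x`. -/
theorem tauberian_reduction (A B E : ℝ → ℝ) (c D K : ℝ)
    (hA : MonotoneOn A (Set.Ici 1))
    (hB : ∀ x : ℝ, 1 ≤ x → B x = (1 / x) * ∫ t in (1:ℝ)..x, A t)
    (hc : 0 < c)
    (hE_mono : MonotoneOn E (Set.Ici 1))
    (hE_one : ∀ x : ℝ, 1 ≤ x → 1 ≤ E x)
    (hE_tendsto : Filter.Tendsto E Filter.atTop Filter.atTop)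
    (hD : 1 ≤ D)
    (hE_doubling : ∀ x : ℝ, 1 ≤ x → E (2 * x) ≤ D * E x)
    (hBE : ∀ x : ℝ, 1 ≤ x → |B x - c * x| ≤ K * x / E x) :
    ∃ (K' x₀ : ℝ), 1 ≤ x₀ ∧
      ∀ x : ℝ, x₀ ≤ x → |A x - 2 * c * x| ≤ K' * x / Real.sqrt (E x) := by
  have hK : 0 ≤ K := by
    have h1 := (abs_nonneg _).trans (hBE 1 le_rfl)
    have h2 := hE_one 1 le_rfl
    rw [mul_one] at h1
    by_contra! hneg
    exact absurd h1 (not_le.2 (div_neg_of_neg_of_pos hneg (by linarith)))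
  have hint : ∀ a b : ℝ, 1 ≤ a → 1 ≤ b → IntervalIntegrable A volume a b := fun a b ha hb =>
    MonotoneOn.intervalIntegrable (hA.mono fun t ht => (le_inf ha hb).trans ht.1)
  have hI : ∀ x : ℝ, 1 ≤ x → |(∫ t in (1:ℝ)..x, A t) - c * x ^ 2| ≤ K * (x ^ 2 / E x) := by
    intro x hx
    have hx0 : 0 < x := by linarith
    have h := mul_le_mul_of_nonneg_left (hBE x hx) hx0.le
    have hscale : (∫ t in (1:ℝ)..x, A t) - c * x ^ 2 = x * (B x - c * x) := by
      rw [hB x hx]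
      field_simp
    rw [hscale, abs_mul, abs_of_pos hx0]
    exact h.trans_eq (by ring)
  refine ⟨c + 20 * K + 4 * K * D, 2, by norm_num, fun x hx => ?_⟩
  have hEx : 1 ≤ E x := hE_one x (by linarith)
  have hs1 : 1 ≤ √(E x) := Real.one_le_sqrt.2 hEx
  have hs2 : √(E x) ^ 2 = E x := Real.sq_sqrt (by linarith)
  obtain ⟨h, hh⟩ : ∃ h, h = x / √(E x) / 2 := ⟨_, rfl⟩
  have hhpos : 0 < h := by rw [hh]; positivity
  have hhx : h ≤ x / 2 := by
    rw [hh]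
    gcongr
    exact div_le_self (by linarith) hs1
  have hquot : x ^ 2 / E x = 4 * h ^ 2 := by
    rw [hh, ← hs2, Real.sqrt_sq (by linarith)]
    field_simp
    norm_num
  have hright : (x + h) ^ 2 / E (x + h) ≤ 16 * h ^ 2 := by
    calc (x + h) ^ 2 / E (x + h) ≤ (2 * x) ^ 2 / E x := by
          gcongr
          · linarith
          · exact hE_mono (Set.mem_Ici.2 (by linarith)) (Set.mem_Ici.2 (by linarith)) (by linarith)
      _ = 4 * (x ^ 2 / E x) := by ring
      _ = 16 * h ^ 2 := by rw [hquot]; ring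
  have hleft : (x - h) ^ 2 / E (x - h) ≤ 4 * D * h ^ 2 := by
    have hEhalf : E x ≤ D * E (x - h) := by
      have h1 := hE_doubling (x - h) (by linarith)
      have h2 : E x ≤ E (2 * (x - h)) :=
        hE_mono (Set.mem_Ici.2 (by linarith)) (Set.mem_Ici.2 (by linarith)) (by linarith)
      exact h2.trans h1
    have hpos : 0 < E (x - h) := by linarith [hE_one (x - h) (by linarith)]
    calc (x - h) ^ 2 / E (x - h) ≤ x ^ 2 / E (x - h) := by
          gcongr
          · linarith
          · linarith
      _ ≤ D * (x ^ 2 / E x) := by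
          rw [← mul_div_assoc, div_le_div_iff₀ hpos (by linarith)]
          nlinarith [mul_le_mul_of_nonneg_left hEhalf (sq_nonneg x)]
      _ = 4 * D * h ^ 2 := by rw [hquot]; ring
  have hmid := abs_le.1 (hI x (by linarith))
  have hplus := abs_le.1 (hI (x + h) (by linarith))
  have hminus := abs_le.1 (hI (x - h) (by linarith))
  rw [hquot] at hmid
  have hKright := mul_le_mul_of_nonneg_left hright hK
  have hKleft := mul_le_mul_of_nonneg_left hleft hK
  have hup := (MonotoneOn.sub_mul_le_intervalIntegral_and_le (by linarith : x ≤ x + h)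
    (hA.mono fun t ht => Set.mem_Ici.2 (by linarith [ht.1]))).1
  have hlow := (MonotoneOn.sub_mul_le_intervalIntegral_and_le (by linarith : x - h ≤ x)
    (hA.mono fun t ht => Set.mem_Ici.2 (by linarith [ht.1]))).2
  have hadd := intervalIntegral.integral_add_adjacent_intervals
    (hint 1 x le_rfl (by linarith)) (hint x (x + h) (by linarith) (by linarith))
  have hsub := intervalIntegral.integral_add_adjacent_intervals
    (hint 1 (x - h) le_rfl (by linarith)) (hint (x - h) x (by linarith) (by linarith))
  have hupper : A x - 2 * c * x ≤ (c + 20 * K) * h := by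
    refine le_of_mul_le_mul_left ?_ hhpos
    linarith
  have hlower : -((c + 4 * K + 4 * K * D) * h) ≤ A x - 2 * c * x := by
    refine le_of_mul_le_mul_left ?_ hhpos
    linarith
  have hKh : 0 ≤ K * h := by positivity
  have hKDh : 0 ≤ K * D * h := by positivity
  have hch : 0 ≤ c * h := by positivity
  have hbound : (c + 20 * K + 4 * K * D) * x / √(E x) = (c + 20 * K + 4 * K * D) * (2 * h) := by
    rw [hh]
    ring
  rw [hbound, abs_le]
  constructor <;> linarith
end

section
/- Let b : ℕ → ℝ be a sequence with b(m) ≥ 0 for all m ≥ 1, let j ≥ 1 be an integer, let 0 < α ≤ 1 and c ≥ 0 be real. Suppose there is a constant K such that |C_j(x) − cx| ≤ K·x^{1−α} for all x ≥ 1, where C_j(x) = ∑_{1 ≤ m ≤ x} b(m)(1 − m/x)^j. Then there exists a constant K' such that |C_{j−1}(x) − ((j+1)/j)·c·x| ≤ K'·x^{1−α/2} for all x ≥ 1, where C_{j−1}(x) = ∑_{1 ≤ m ≤ x} b(m)(1 − m/x)^{j−1}. -/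
open Finset

/-- Tangent line inequality for `t ↦ t ^ (k + 1)` on the nonnegative reals. -/
lemma tangent_le_pow_succ {a b : ℝ} (ha : 0 ≤ a) (hb : 0 ≤ b) (k : ℕ) :
    (k + 1) * (b - a) * a ^ k ≤ b ^ (k + 1) - a ^ (k + 1) := by
  induction k with
  | zero => simp
  | succ k ih =>
    have h1 := mul_le_mul_of_nonneg_right ih hb
    have h2 : 0 ≤ ((k : ℝ) + 1) * a ^ k * (b - a) ^ 2 := by positivity
    push_cast
    ring_nf at h1 h2 ⊢
    linarith

/-- Second order bound for `(1 + t) ^ n` on `[-1, 1]`. -/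
lemma one_add_pow_le_quadratic {t : ℝ} (h1 : -1 ≤ t) (h2 : t ≤ 1) (n : ℕ) :
    (1 + t) ^ n ≤ 1 + n * t + 4 ^ n * t ^ 2 := by
  induction n with
  | zero => simp [sq_nonneg]
  | succ n ih =>
    have h3 := mul_le_mul_of_nonneg_right ih (by linarith : 0 ≤ 1 + t)
    have h4 : (n : ℝ) ≤ 4 ^ n := by exact_mod_cast (Nat.lt_pow_self (by norm_num)).le
    have h5 : (n : ℝ) * t ^ 2 ≤ 4 ^ n * t ^ 2 := by gcongr
    have h6 : 0 ≤ 4 ^ n * t ^ 2 * (1 - t) :=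
      mul_nonneg (by positivity) (by linarith)
    have h7 : (0 : ℝ) ≤ 4 ^ n * t ^ 2 := by positivity
    rw [pow_succ, pow_succ (4 : ℝ)]
    push_cast
    linarith

lemma sum_Icc_floor_eq_sum_ite (f : ℕ → ℝ) {x : ℝ} {N : ℕ} (hN : ⌊x⌋₊ ≤ N) :
    ∑ m ∈ Icc 1 ⌊x⌋₊, f m = ∑ m ∈ Icc 1 N, if (m : ℝ) ≤ x then f m else 0 := by
  rw [← sum_filter]
  congr 1
  ext m
  simp only [mem_Icc, mem_filter]
  constructor
  · rintro ⟨h1, h2⟩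
    exact ⟨⟨h1, h2.trans hN⟩, (Nat.le_floor_iff' (by omega)).1 h2⟩
  · rintro ⟨⟨h1, -⟩, h2⟩
    exact ⟨h1, Nat.le_floor h2⟩

/-- The function `x ↦ ∑_{m ≤ x} b m (x - m) ^ (k + 1)` lies above its tangent lines. -/
lemma tangent_le_sum_mul_pow_succ {b : ℕ → ℝ} (hb : ∀ m : ℕ, 1 ≤ m → 0 ≤ b m) (k : ℕ)
    (x y : ℝ) :
    (k + 1) * (y - x) * ∑ m ∈ Icc 1 ⌊x⌋₊, b m * (x - m) ^ k ≤
      ∑ m ∈ Icc 1 ⌊y⌋₊, b m * (y - m) ^ (k + 1) -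
        ∑ m ∈ Icc 1 ⌊x⌋₊, b m * (x - m) ^ (k + 1) := by
  rw [sum_Icc_floor_eq_sum_ite _ (le_max_left ⌊x⌋₊ ⌊y⌋₊),
    sum_Icc_floor_eq_sum_ite _ (le_max_left ⌊x⌋₊ ⌊y⌋₊),
    sum_Icc_floor_eq_sum_ite _ (le_max_right ⌊x⌋₊ ⌊y⌋₊), mul_sum, ← sum_sub_distrib]
  refine sum_le_sum fun m hm => ?_
  have hbm := hb m (mem_Icc.1 hm).1
  by_cases hx : (m : ℝ) ≤ x <;> by_cases hy : (m : ℝ) ≤ y <;>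
    simp only [hx, hy, if_true, if_false]
  · have h := mul_le_mul_of_nonneg_left
      (tangent_le_pow_succ (sub_nonneg.2 hx) (sub_nonneg.2 hy) k) hbm
    linarith
  · have hp : 0 ≤ b m * (x - m) ^ k := mul_nonneg hbm (pow_nonneg (sub_nonneg.2 hx) k)
    have h1 : 0 ≤ b m * (x - m) ^ k * (m - y) * (k + 1) :=
      mul_nonneg (mul_nonneg hp (by linarith)) (by positivity)
    have h2 : 0 ≤ b m * (x - m) ^ k * (x - m) * k :=
      mul_nonneg (mul_nonneg hp (by linarith)) (by positivity)
    rw [pow_succ]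
    linarith
  · have := mul_nonneg hbm (pow_nonneg (sub_nonneg.2 hy) (k + 1))
    linarith
  · simp

lemma sum_mul_sub_pow_eq (b : ℕ → ℝ) (k : ℕ) {x : ℝ} (hx : x ≠ 0) (s : Finset ℕ) :
    ∑ m ∈ s, b m * (x - m) ^ k = x ^ k * ∑ m ∈ s, b m * (1 - (m : ℝ) / x) ^ k := by
  rw [mul_sum]
  refine sum_congr rfl fun m _ => ?_
  rw [mul_left_comm, ← mul_pow, mul_sub, mul_one, mul_div_cancel₀ _ hx]

/-- A power-saving bound for the unnormalised Riesz sum at `z`, uniform over `0 ≤ z ≤ 2 * x`. -/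
lemma abs_sum_mul_pow_sub_le (b : ℕ → ℝ) (n : ℕ) {α c K : ℝ} (hα0 : 0 < α) (hα1 : α ≤ 1)
    (hc : 0 ≤ c) (hK0 : 0 ≤ K)
    (hK : ∀ x : ℝ, 1 ≤ x →
      |(∑ m ∈ Icc 1 ⌊x⌋₊, b m * (1 - (m : ℝ) / x) ^ n) - c * x| ≤ K * x ^ (1 - α))
    {x z : ℝ} (hx : 1 ≤ x) (hz0 : 0 ≤ z) (hz : z ≤ 2 * x) :
    |∑ m ∈ Icc 1 ⌊z⌋₊, b m * (z - m) ^ n - c * z ^ (n + 1)| ≤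
      (K * 2 ^ (n + 1) + c) * (x ^ n * x ^ (1 - α)) := by
  have hone : 1 ≤ x ^ n * x ^ (1 - α) :=
    one_le_mul_of_one_le_of_one_le (one_le_pow₀ hx) (Real.one_le_rpow hx (by linarith))
  rw [add_mul]
  rcases lt_or_ge z 1 with h | h
  · rw [Nat.floor_eq_zero.2 h]
    have h1 : c * z ^ (n + 1) ≤ c * (x ^ n * x ^ (1 - α)) :=
      mul_le_mul_of_nonneg_left ((pow_le_one₀ hz0 h.le).trans hone) hc
    have h2 : 0 ≤ K * 2 ^ (n + 1) * (x ^ n * x ^ (1 - α)) := by positivity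
    simp only [zero_lt_one, Icc_eq_empty_of_lt, sum_empty, zero_sub, abs_neg]
    rw [abs_of_nonneg (by positivity)]
    linarith
  · have hz1 : 0 < z := by linarith
    have h1 : z ^ (1 - α) ≤ 2 * x ^ (1 - α) := by
      calc z ^ (1 - α) ≤ (2 * x) ^ (1 - α) := Real.rpow_le_rpow hz0 hz (by linarith)
        _ = 2 ^ (1 - α) * x ^ (1 - α) := Real.mul_rpow (by norm_num) (by linarith)
        _ ≤ 2 ^ (1 : ℝ) * x ^ (1 - α) := by gcongr <;> linarith
        _ = 2 * x ^ (1 - α) := by rw [Real.rpow_one]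
    have h2 : z ^ n ≤ 2 ^ n * x ^ n := by
      rw [← mul_pow]
      gcongr
    have h3 : 0 ≤ c * (x ^ n * x ^ (1 - α)) := by positivity
    rw [sum_mul_sub_pow_eq b n hz1.ne', show ∀ S : ℝ, z ^ n * S - c * z ^ (n + 1) =
      z ^ n * (S - c * z) from fun S => by ring, abs_mul, abs_of_nonneg (by positivity)]
    calc z ^ n * |_| ≤ z ^ n * (K * z ^ (1 - α)) := by gcongr; exact hK z h
      _ ≤ (2 ^ n * x ^ n) * (K * (2 * x ^ (1 - α))) := by gcongr
      _ = K * 2 ^ (n + 1) * (x ^ n * x ^ (1 - α)) := by ring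
      _ ≤ _ := by linarith

/-- Single Tauberian descent step for Riesz means (corrected form, with constant
`(j+1)/j`): if `b(m) ≥ 0` for `m ≥ 1`, `j ≥ 1`, `0 < α ≤ 1`, `c ≥ 0` and
`|C_j(x) − cx| ≤ K·x^{1−α}` for all `x ≥ 1`, where
`C_j(x) = ∑_{1 ≤ m ≤ x} b(m)(1 − m/x)^j`, then there is `K'` with
`|C_{j−1}(x) − ((j+1)/j)·c·x| ≤ K'·x^{1−α/2}` for all `x ≥ 1`. -/
theorem riesz_mean_descent_step (b : ℕ → ℝ) (hb : ∀ m : ℕ, 1 ≤ m → 0 ≤ b m)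
    (j : ℕ) (hj : 1 ≤ j) (α c K : ℝ) (hα0 : 0 < α) (hα1 : α ≤ 1) (hc : 0 ≤ c)
    (hK : ∀ x : ℝ, 1 ≤ x →
      |(∑ m ∈ Finset.Icc 1 ⌊x⌋₊, b m * (1 - (m : ℝ) / x) ^ j) - c * x| ≤
        K * x ^ (1 - α)) :
    ∃ K' : ℝ, ∀ x : ℝ, 1 ≤ x →
      |(∑ m ∈ Finset.Icc 1 ⌊x⌋₊, b m * (1 - (m : ℝ) / x) ^ (j - 1)) -
          ((j + 1 : ℝ) / j) * c * x| ≤ K' * x ^ (1 - α / 2) := by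
  obtain ⟨k, rfl⟩ : ∃ k, j = k + 1 := ⟨j - 1, by omega⟩
  have hK0 : 0 ≤ K := by simpa using (abs_nonneg _).trans (hK 1 le_rfl)
  set L : ℝ := K * 2 ^ (k + 1 + 1) + c
  set A : ℝ := c * 4 ^ (k + 2) + 2 * L
  refine ⟨A / (k + 1), fun x hx => ?_⟩
  have hx0 : 0 < x := by linarith
  rw [Nat.add_sub_cancel]
  set S := ∑ m ∈ Icc 1 ⌊x⌋₊, b m * (1 - (m : ℝ) / x) ^ k with hS
  have key : ∀ t : ℝ, -1 ≤ t → t ≤ 1 → t ^ 2 = x ^ (-α) →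
      t * ((k + 1) * S - (k + 2) * c * x) ≤ A * x ^ (1 - α) := by
    intro t ht1 ht2 ht
    have h1 := tangent_le_sum_mul_pow_succ hb k x (x * (1 + t))
    have h2 := abs_le.1 (abs_sum_mul_pow_sub_le b (k + 1) hα0 hα1 hc hK0 hK hx
      (z := x * (1 + t)) (mul_nonneg hx0.le (by linarith)) (by nlinarith))
    have h3 := abs_le.1 (abs_sum_mul_pow_sub_le b (k + 1) hα0 hα1 hc hK0 hK hx
      (z := x) hx0.le (by linarith))
    have h4 := mul_le_mul_of_nonneg_left (one_add_pow_le_quadratic ht1 ht2 (k + 2))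
      (by positivity : 0 ≤ c * x ^ (k + 2))
    rw [sum_mul_sub_pow_eq b k hx0.ne', ← hS] at h1
    have hxα : x ^ (1 - α) = x * x ^ (-α) := by
      rw [sub_eq_add_neg, Real.rpow_add hx0, Real.rpow_one]
    rw [hxα] at h2 h3 ⊢
    rw [ht] at h4
    rw [mul_pow] at h2
    refine le_of_mul_le_mul_left ?_ (pow_pos hx0 (k + 1))
    simp only [A, L]
    push_cast at h4
    have h5 := h2.2
    have h6 := h3.1
    ring_nf at h1 h4 h5 h6 ⊢
    linarith
  set δ := x ^ (-(α / 2)) with hδ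
  have hδ0 : 0 < δ := Real.rpow_pos_of_pos hx0 _
  have hδ1 : δ ≤ 1 := Real.rpow_le_one_of_one_le_of_nonpos hx (by linarith)
  have hδ2 : δ ^ 2 = x ^ (-α) := by
    rw [sq, ← Real.rpow_add hx0]
    ring_nf
  have hδx : x ^ (1 - α) = δ * x ^ (1 - α / 2) := by
    rw [← Real.rpow_add hx0]
    ring_nf
  have hp := key δ (by linarith) hδ1 hδ2
  have hn := key (-δ) (by linarith) (by linarith) (by rw [neg_sq, hδ2])
  rw [hδx] at hp hn
  have habs : |(k + 1) * S - (k + 2) * c * x| ≤ A * x ^ (1 - α / 2) :=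
    abs_le'.2 ⟨le_of_mul_le_mul_left (by linarith) hδ0,
      le_of_mul_le_mul_left (by linarith) hδ0⟩
  have hk : (0 : ℝ) < k + 1 := by positivity
  have heq : S - (((k + 1 : ℕ) : ℝ) + 1) / ((k + 1 : ℕ) : ℝ) * c * x =
      ((k + 1) * S - (k + 2) * c * x) / (k + 1) := by
    push_cast
    field_simp
    ring
  rw [heq, abs_div, abs_of_pos hk, div_mul_eq_mul_div]
  gcongr
end

section
/- Let b : ℕ → ℝ be a sequence with b(m) ≥ 0 for all m ≥ 1, let k ≥ 1 be an integer and c ≥ 0 real. Suppose there is a constant K such that |∑_{1 ≤ m ≤ x} b(m)(1 − m/x)^k − cx| ≤ K for all x ≥ 1. Then there exists a constant K' such that |∑_{1 ≤ m ≤ x} b(m) − (k+1)·c·x| ≤ K'·x^{1 − 1/2^k} for all x ≥ 1. -/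
open Finset

/-- The unnormalised Riesz mean `∑_{1 ≤ m ≤ x} b(m)(x − m)^n`. -/
noncomputable def rieszSum (b : ℕ → ℝ) (n : ℕ) (x : ℝ) : ℝ :=
  ∑ m ∈ Finset.Icc 1 ⌊x⌋₊, b m * (x - m) ^ n

theorem pow_succ_add_mul_le {u v : ℝ} (hu : 0 ≤ u) (hv : 0 ≤ v) (n : ℕ) :
    u ^ (n + 1) + (n + 1) * (v - u) * u ^ n ≤ v ^ (n + 1) := by
  induction n with
  | zero => simp
  | succ n ih =>
    have h1 := mul_le_mul_of_nonneg_left ih hv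
    have h2 : 0 ≤ (n + 1 : ℝ) * (v - u) ^ 2 * u ^ n := by positivity
    push_cast
    have h3 : v ^ (n + 1 + 1) = v * v ^ (n + 1) := pow_succ' _ _
    rw [h3]
    refine le_trans ?_ h1
    rw [← sub_nonneg]
    refine h2.trans_eq ?_
    ring

theorem exists_pow_le_taylor (n : ℕ) : ∃ M : ℝ, 0 ≤ M ∧ ∀ x y : ℝ, 0 ≤ x → 0 ≤ y → y ≤ 2 * x →
    y ^ (n + 2) ≤ x ^ (n + 2) + (n + 2) * (y - x) * x ^ (n + 1) + M * (x ^ n * (y - x) ^ 2) := by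
  induction n with
  | zero =>
    refine ⟨1, zero_le_one, fun x y _ _ _ => le_of_eq ?_⟩
    norm_num
    ring
  | succ n ih =>
    obtain ⟨M, hM, h⟩ := ih
    refine ⟨2 * M + (n + 2), by positivity, fun x y hx hy hxy => ?_⟩
    have h1 := mul_le_mul_of_nonneg_left (h x y hx hy hxy) hy
    have h2 : y * (M * (x ^ n * (y - x) ^ 2)) ≤ 2 * x * (M * (x ^ n * (y - x) ^ 2)) :=
      mul_le_mul_of_nonneg_right hxy (by positivity)
    push_cast
    have h3 : y ^ (n + 1 + 2) = y * y ^ (n + 2) := pow_succ' _ _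
    rw [h3]
    refine h1.trans ?_
    rw [← sub_nonneg] at h2 ⊢
    refine h2.trans_eq ?_
    ring

theorem rieszSum_eq_sum_ite (b : ℕ → ℝ) (n N : ℕ) {x : ℝ} (hx : 0 ≤ x) (hN : ⌊x⌋₊ ≤ N) :
    rieszSum b n x = ∑ m ∈ Finset.Icc 1 N, b m * (if (m : ℝ) ≤ x then (x - m) ^ n else 0) := by
  unfold rieszSum
  rw [← Finset.sum_subset (Finset.Icc_subset_Icc_right hN)]
  · refine Finset.sum_congr rfl fun m hm => ?_
    rw [if_pos ((Nat.le_floor_iff hx).1 (Finset.mem_Icc.1 hm).2)]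
  · intro m hm hm'
    rw [if_neg, mul_zero]
    intro hmx
    exact hm' (Finset.mem_Icc.2 ⟨(Finset.mem_Icc.1 hm).1, Nat.le_floor hmx⟩)

theorem rieszSum_succ_add_mul_le {b : ℕ → ℝ} (hb : ∀ m : ℕ, 1 ≤ m → 0 ≤ b m) (n : ℕ) {x y : ℝ}
    (hx : 0 ≤ x) (hy : 0 ≤ y) :
    rieszSum b (n + 1) x + (n + 1) * (y - x) * rieszSum b n x ≤ rieszSum b (n + 1) y := by
  rw [rieszSum_eq_sum_ite b (n + 1) _ hx (le_max_left _ ⌊y⌋₊),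
    rieszSum_eq_sum_ite b n _ hx (le_max_left _ ⌊y⌋₊),
    rieszSum_eq_sum_ite b (n + 1) _ hy (le_max_right ⌊x⌋₊ _), Finset.mul_sum,
    ← Finset.sum_add_distrib]
  refine Finset.sum_le_sum fun m hm => ?_
  rw [mul_left_comm, ← mul_add]
  refine mul_le_mul_of_nonneg_left ?_ (hb m (Finset.mem_Icc.1 hm).1)
  by_cases hmx : (m : ℝ) ≤ x
  · have hu := sub_nonneg.2 hmx
    simp only [if_pos hmx]
    by_cases hmy : (m : ℝ) ≤ y
    · simpa only [if_pos hmy, sub_sub_sub_cancel_right] using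
        pow_succ_add_mul_le hu (sub_nonneg.2 hmy) n
    · rw [if_neg hmy, pow_succ', ← add_mul]
      refine mul_nonpos_of_nonpos_of_nonneg ?_ (by positivity)
      have : 0 ≤ (n : ℝ) * (x - y) := mul_nonneg n.cast_nonneg (by linarith)
      linarith
  · simp only [if_neg hmx, mul_zero, add_zero]
    split_ifs with hmy
    · exact pow_nonneg (sub_nonneg.2 hmy) _
    · exact le_rfl

/-- One step of the Tauberian descent: the order of the Riesz mean drops by one and the saving in
the exponent is halved. -/
theorem rieszSum_descent_step {b : ℕ → ℝ} (hb : ∀ m : ℕ, 1 ≤ m → 0 ≤ b m) (n : ℕ) {A K δ : ℝ}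
    (hδ0 : 0 ≤ δ) (hδ1 : δ ≤ 1)
    (hK : ∀ x : ℝ, 1 ≤ x → |rieszSum b (n + 1) x - A * x ^ (n + 2)| ≤ K * x ^ (n + 2 - δ)) :
    ∃ K' : ℝ, ∀ x : ℝ, 1 ≤ x →
      |rieszSum b n x - A * (n + 2) / (n + 1) * x ^ (n + 1)| ≤ K' * x ^ (n + 1 - δ / 2) := by
  obtain ⟨M, hM, hT⟩ := exists_pow_le_taylor n
  set B : ℝ := |K| * 2 ^ (n + 2 - δ) + |A| with hB
  refine ⟨(|A| * M + 2 * B) / (n + 1), fun x hx => ?_⟩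
  have hx0 : 0 < x := by linarith
  set h : ℝ := x ^ (1 - δ / 2) with hh
  have h0 : 0 < h := Real.rpow_pos_of_pos hx0 _
  have hhx : h ≤ x := by
    simpa using Real.rpow_le_rpow_of_exponent_le hx (show 1 - δ / 2 ≤ 1 by linarith)
  have hpow1 : x ^ (n + 1 - δ / 2) = x ^ n * h := by
    rw [hh, ← Real.rpow_natCast, ← Real.rpow_add hx0]
    ring_nf
  have hpow2 : x ^ (n + 2 - δ) = x ^ n * h ^ 2 := by
    rw [pow_two, ← mul_assoc, ← hpow1, hh, ← Real.rpow_add hx0]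
    ring_nf
  have hn : (0 : ℝ) ≤ n := n.cast_nonneg
  have hexp : 0 ≤ n + 2 - δ := by linarith
  have hone : 1 ≤ x ^ n * h ^ 2 := hpow2 ▸ Real.one_le_rpow hx hexp
  have key : ∀ y : ℝ, 0 ≤ y → y ≤ 2 * x →
      |rieszSum b (n + 1) y - A * y ^ (n + 2)| ≤ B * (x ^ n * h ^ 2) := by
    intro y hy hyx
    rw [hB, add_mul]
    rcases le_or_gt 1 y with hy1 | hy1
    · have hle : y ^ (n + 2 - δ) ≤ 2 ^ (n + 2 - δ) * (x ^ n * h ^ 2) := by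
        rw [← hpow2, ← Real.mul_rpow zero_le_two hx0.le]
        exact Real.rpow_le_rpow hy hyx hexp
      calc |rieszSum b (n + 1) y - A * y ^ (n + 2)| ≤ K * y ^ (n + 2 - δ) := hK y hy1
        _ ≤ |K| * y ^ (n + 2 - δ) :=
          mul_le_mul_of_nonneg_right (le_abs_self K) (Real.rpow_nonneg hy _)
        _ ≤ |K| * (2 ^ (n + 2 - δ) * (x ^ n * h ^ 2)) :=
          mul_le_mul_of_nonneg_left hle (abs_nonneg K)
        _ ≤ |K| * 2 ^ (n + 2 - δ) * (x ^ n * h ^ 2) + |A| * (x ^ n * h ^ 2) := by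
          rw [← mul_assoc]
          exact le_add_of_nonneg_right (by positivity)
    · have hS : rieszSum b (n + 1) y = 0 := by
        simp [rieszSum, Nat.floor_eq_zero.2 hy1]
      have hle : |A| * y ^ (n + 2) ≤ |A| * (x ^ n * h ^ 2) :=
        mul_le_mul_of_nonneg_left ((pow_le_one₀ hy hy1.le).trans hone) (abs_nonneg A)
      rw [hS, zero_sub, abs_neg, abs_mul, abs_of_nonneg (pow_nonneg hy _)]
      exact hle.trans (le_add_of_nonneg_left (by positivity))
  have increment : ∀ s : ℝ, s ^ 2 = h ^ 2 → 0 ≤ x + s → x + s ≤ 2 * x →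
      s * ((n + 1) * rieszSum b n x - A * (n + 2) * x ^ (n + 1)) ≤
        h * ((|A| * M + 2 * B) * (x ^ n * h)) := by
    intro s hs hs0 hs1
    have h1 := rieszSum_succ_add_mul_le hb n hx0.le hs0
    have h2 := (abs_le.1 (key (x + s) hs0 hs1)).2
    have h3 := (abs_le.1 (key x hx0.le (by linarith))).1
    have h4 := hT x (x + s) hx0.le hs0 hs1
    have h5 := pow_succ_add_mul_le hx0.le hs0 (n + 1)
    push_cast at h5
    rw [add_sub_cancel_left] at h1 h4 h5
    rw [hs] at h4
    set D := (x + s) ^ (n + 2) - x ^ (n + 2) - (n + 2) * s * x ^ (n + 1) with hD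
    have hD0 : 0 ≤ D := by
      rw [hD]
      linarith
    have hD1 : D ≤ M * (x ^ n * h ^ 2) := by
      rw [hD]
      linarith
    have h6 : A * D ≤ |A| * (M * (x ^ n * h ^ 2)) :=
      mul_le_mul (le_abs_self A) hD1 hD0 (abs_nonneg A)
    rw [hD] at h6
    linarith
  have hup := le_of_mul_le_mul_left (increment h rfl (by linarith) (by linarith)) h0
  have hlow := increment (-h) (neg_sq h) (by linarith) (by linarith)
  rw [neg_mul_comm] at hlow
  replace hlow := le_of_mul_le_mul_left hlow h0
  have hn1 : (0 : ℝ) < n + 1 := by positivity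
  have heq : rieszSum b n x - A * (n + 2) / (n + 1) * x ^ (n + 1) =
      ((n + 1) * rieszSum b n x - A * (n + 2) * x ^ (n + 1)) / (n + 1) := by
    field_simp
  rw [heq, abs_div, abs_of_pos hn1, hpow1, div_mul_eq_mul_div]
  exact div_le_div_of_nonneg_right (abs_le.2 ⟨by linarith, hup⟩) hn1.le

theorem rieszSum_descent {b : ℕ → ℝ} (hb : ∀ m : ℕ, 1 ≤ m → 0 ≤ b m) (n : ℕ) {A K δ : ℝ}
    (hδ0 : 0 ≤ δ) (hδ1 : δ ≤ 1)
    (hK : ∀ x : ℝ, 1 ≤ x → |rieszSum b n x - A * x ^ (n + 1)| ≤ K * x ^ (n + 1 - δ)) :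
    ∃ K' : ℝ, ∀ x : ℝ, 1 ≤ x →
      |rieszSum b 0 x - (n + 1) * A * x| ≤ K' * x ^ (1 - δ / 2 ^ n) := by
  induction n generalizing A K δ with
  | zero => exact ⟨K, by simpa using hK⟩
  | succ n ih =>
    have hcast : ((n + 1 : ℕ) : ℝ) + 1 - δ = n + 2 - δ := by
      push_cast
      ring
    simp only [hcast] at hK
    obtain ⟨K₁, hK₁⟩ := rieszSum_descent_step hb n hδ0 hδ1 hK
    obtain ⟨K₂, hK₂⟩ := ih (by linarith) (by linarith) hK₁
    refine ⟨K₂, fun x hx => ?_⟩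
    have h1 : (((n + 1 : ℕ) : ℝ) + 1) * A = (n + 1) * (A * (n + 2) / (n + 1)) := by
      push_cast
      field_simp
      ring
    have h2 : δ / 2 ^ (n + 1) = δ / 2 / 2 ^ n := by rw [pow_succ', div_div]
    rw [h1, h2]
    exact hK₂ x hx

/-- Iterated Tauberian descent (corrected form of the reduction used for Theorem 1.2):
if `b(m) ≥ 0` for `m ≥ 1`, `k ≥ 1`, `c ≥ 0` and
`|∑_{1 ≤ m ≤ x} b(m)(1 − m/x)^k − cx| ≤ K` for all `x ≥ 1`, then there is `K'` with
`|∑_{1 ≤ m ≤ x} b(m) − (k+1)·c·x| ≤ K'·x^{1 − 1/2^k}` for all `x ≥ 1`. -/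
theorem riesz_mean_iterated_descent (b : ℕ → ℝ) (hb : ∀ m : ℕ, 1 ≤ m → 0 ≤ b m)
    (k : ℕ) (hk : 1 ≤ k) (c K : ℝ) (hc : 0 ≤ c)
    (hK : ∀ x : ℝ, 1 ≤ x →
      |(∑ m ∈ Finset.Icc 1 ⌊x⌋₊, b m * (1 - (m : ℝ) / x) ^ k) - c * x| ≤ K) :
    ∃ K' : ℝ, ∀ x : ℝ, 1 ≤ x →
      |(∑ m ∈ Finset.Icc 1 ⌊x⌋₊, b m) - (k + 1 : ℝ) * c * x| ≤
        K' * x ^ (1 - 1 / 2 ^ k : ℝ) := by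
  have hS : ∀ x : ℝ, 1 ≤ x →
      |rieszSum b k x - c * x ^ (k + 1)| ≤ K * x ^ (k + 1 - 1 : ℝ) := by
    intro x hx
    have hx0 : 0 < x := by linarith
    have heq : rieszSum b k x - c * x ^ (k + 1) =
        x ^ k * ((∑ m ∈ Finset.Icc 1 ⌊x⌋₊, b m * (1 - (m : ℝ) / x) ^ k) - c * x) := by
      rw [mul_sub, Finset.mul_sum, rieszSum]
      congr 1
      · refine Finset.sum_congr rfl fun m _ => ?_
        rw [mul_left_comm, ← mul_pow, mul_sub, mul_one, mul_div_cancel₀ _ hx0.ne']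
      · ring
    rw [heq, abs_mul, abs_of_pos (pow_pos hx0 k), add_sub_cancel_right, Real.rpow_natCast,
      mul_comm K]
    exact mul_le_mul_of_nonneg_left (hK x hx) (by positivity)
  simpa [rieszSum] using rieszSum_descent hb k zero_le_one le_rfl hS
end
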